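/- The double cover Ã_4 of the alternating group on 4 letters is isomorphic, as a group, to the special linear group SL(2, 3), i.e. there is a multiplicative equivalence Ã_4 ≃* Matrix.SpecialLinearGroup (Fin 2) (ZMod 3). -/

import Mathlib

/-- Relations defining the double cover `S̃ₙ` of the symmetric group:
generators are `none = z` and `some i = tᵢ` for `i : Fin (n-1)`, with relations
`z² = 1`, `tᵢ² = z`, `(tᵢ tᵢ₊₁)³ = z` and `(tᵢ tⱼ)² = z` for `|i - j| ≥ 2`. -/
def spinRels (n : ℕ) : Set (FreeGroup (Option (Fin (n - 1)))) :=
  {r | r = FreeGroup.of (none : Option (Fin (n - 1))) ^ 2}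
  ∪ {r | ∃ i : Fin (n - 1), r = FreeGroup.of (some i) ^ 2 * (FreeGroup.of none)⁻¹}
  ∪ {r | ∃ i j : Fin (n - 1), (j : ℕ) = (i : ℕ) + 1 ∧
      r = (FreeGroup.of (some i) * FreeGroup.of (some j)) ^ 3 * (FreeGroup.of none)⁻¹}
  ∪ {r | ∃ i j : Fin (n - 1), ((i : ℕ) + 2 ≤ (j : ℕ) ∨ (j : ℕ) + 2 ≤ (i : ℕ)) ∧
      r = (FreeGroup.of (some i) * FreeGroup.of (some j)) ^ 2 * (FreeGroup.of none)⁻¹}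

/-- The double cover `S̃ₙ` of the symmetric group, as a presented group. -/
abbrev SpinSym (n : ℕ) : Type := PresentedGroup (spinRels n)

/-- The central element `z` of `S̃ₙ`. -/
def spinZ (n : ℕ) : SpinSym n := PresentedGroup.of none

/-- The generator `tᵢ` of `S̃ₙ`. -/
def spinT (n : ℕ) (i : Fin (n - 1)) : SpinSym n := PresentedGroup.of (some i)

/-- The `i`-th point of `Fin n`, for `i : Fin (n-1)`. -/
def finL {n : ℕ} (i : Fin (n - 1)) : Fin n := ⟨(i : ℕ), by have := i.2; omega⟩

/-- The `(i+1)`-st point of `Fin n`, for `i : Fin (n-1)`. -/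
def finR {n : ℕ} (i : Fin (n - 1)) : Fin n := ⟨(i : ℕ) + 1, by have := i.2; omega⟩

/-- `π : S̃ₙ → Sₙ` is the canonical projection iff `π z = 1` and `π tᵢ` is the
transposition of the `i`-th and `(i+1)`-st points. -/
def IsSpinProj (n : ℕ) (π : SpinSym n →* Equiv.Perm (Fin n)) : Prop :=
  π (spinZ n) = 1 ∧ ∀ i : Fin (n - 1), π (spinT n i) = Equiv.swap (finL i) (finR i)

/-- The double cover `Ãₙ = π⁻¹(Aₙ)` of the alternating group, as a subgroup of `S̃ₙ`. -/
def SpinAlt (n : ℕ) (π : SpinSym n →* Equiv.Perm (Fin n)) : Subgroup (SpinSym n) :=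
  (alternatingGroup (Fin n)).comap π

/-- The central element `z`, as an element of `Ãₙ`. -/
def spinZA (n : ℕ) (π : SpinSym n →* Equiv.Perm (Fin n)) (hπ : IsSpinProj n π) :
    ↥(SpinAlt n π) :=
  ⟨spinZ n, Subgroup.mem_comap.mpr (by rw [hπ.1]; exact Subgroup.one_mem _)⟩

section NormalForm

variable {G : Type*} [Group G] {z a b c : G}

/-- The normal forms `zⁱ aʲ u v`, with `u ∈ {1, b, ba}` and `v ∈ {1, c, cb, cba}`,
of words in a group generated by `z, a, b, c`. -/
def spinNormalForm (z a b c : G) (x : Fin 2 × Fin 2 × Fin 3 × Fin 4) : G :=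
  ![1, z] x.1 * ![1, a] x.2.1 * ![1, b, b * a] x.2.2.1 * ![1, c, c * b, c * b * a] x.2.2.2

lemma map_spinNormalForm {H : Type*} [Group H] (φ : G →* H) (z a b c : G)
    (x : Fin 2 × Fin 2 × Fin 3 × Fin 4) :
    φ (spinNormalForm z a b c x) = spinNormalForm (φ z) (φ a) (φ b) (φ c) x := by
  obtain ⟨i, j, k, l⟩ := x
  simp only [spinNormalForm, map_mul]
  congr 1
  · congr 1
    · congr 1
      · fin_cases i <;> simp
      · fin_cases j <;> simp
    · fin_cases k <;> simp
  · fin_cases l <;> simp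

/-- The defining relations of `S̃₄`, for elements `z, a, b, c` of a group. -/
structure SpinFourRelations (z a b c : G) : Prop where
  z_sq : z ^ 2 = 1
  a_sq : a ^ 2 = z
  b_sq : b ^ 2 = z
  c_sq : c ^ 2 = z
  ab_cube : (a * b) ^ 3 = z
  bc_cube : (b * c) ^ 3 = z
  ac_sq : (a * c) ^ 2 = z

lemma braid_of_sq_eq {x y : G} (hz : z ^ 2 = 1) (hx : x ^ 2 = z) (hy : y ^ 2 = z)
    (hxy : (x * y) ^ 3 = z) : x * y * x = y * x * y := by
  have hx' : x * x * (x * x) = 1 := by rw [← sq x, hx, ← sq, hz]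
  have hy' : y * y = x * x := by rw [← sq, ← sq, hx, hy]
  have h : x * y * x * (y * x * y) = x * x := by
    rw [← sq x, hx, ← hxy]; simp [pow_succ, mul_assoc]
  have h2 : y * x * y * (y * x * y) = x * x := by
    calc y * x * y * (y * x * y) = y * x * (y * y) * x * y := by simp [mul_assoc]
      _ = y * (x * x * (x * x)) * y := by rw [hy']; simp [mul_assoc]
      _ = x * x := by rw [hx', mul_one, hy']
  exact mul_right_cancel (h.trans h2.symm)

lemma mul_comm_of_sq_eq {x : G} (hx : x ^ 2 = z) (v : G) : v * x * z = v * z * x := by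
  simp [← hx, sq, mul_assoc]

namespace SpinFourRelations

variable (h : SpinFourRelations z a b c)
include h

lemma mul_z_z (v : G) : v * z * z = v := by rw [mul_assoc, ← sq, h.z_sq, mul_one]

lemma mul_a_a (v : G) : v * a * a = v * z := by rw [mul_assoc, ← sq, h.a_sq]

lemma mul_b_b (v : G) : v * b * b = v * z := by rw [mul_assoc, ← sq, h.b_sq]

lemma mul_c_c (v : G) : v * c * c = v * z := by rw [mul_assoc, ← sq, h.c_sq]

lemma mul_b_a_b (v : G) : v * b * a * b = v * a * b * a := by
  simpa [mul_assoc] using congrArg (v * ·) (braid_of_sq_eq h.z_sq h.a_sq h.b_sq h.ab_cube).symm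

lemma mul_c_b_c (v : G) : v * c * b * c = v * b * c * b := by
  simpa [mul_assoc] using congrArg (v * ·) (braid_of_sq_eq h.z_sq h.b_sq h.c_sq h.bc_cube).symm

lemma mul_a_z (v : G) : v * a * z = v * z * a := mul_comm_of_sq_eq h.a_sq v

lemma mul_b_z (v : G) : v * b * z = v * z * b := mul_comm_of_sq_eq h.b_sq v

lemma mul_c_z (v : G) : v * c * z = v * z * c := mul_comm_of_sq_eq h.c_sq v

lemma mul_a_c (v : G) : v * a * c = v * z * c * a := by
  have h1 : v * a * c * a * c = v * z := by
    rw [← h.ac_sq]; simp [sq, mul_assoc]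
  have h2 : v * z * c * a * a * c = v * z := by
    rw [h.mul_a_a, h.mul_c_z, h.mul_z_z, h.mul_c_c]
  have h3 := h1.trans h2.symm
  exact mul_right_cancel (mul_right_cancel h3)

lemma mul_c_a (v : G) : v * c * a = v * z * a * c := by
  rw [h.mul_a_c, h.mul_z_z]

end SpinFourRelations

/-- The words `zⁱ aʲ`. -/
def SpinWordTwo (z a w : G) : Prop := w = 1 ∨ w = 1 * z ∨ w = 1 * a ∨ w = 1 * z * a

/-- The words `zⁱ aʲ u` with `u ∈ {1, b, ba}`. -/
def SpinWordThree (z a b w : G) : Prop :=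
  ∃ v, SpinWordTwo z a v ∧ (w = v ∨ w = v * b ∨ w = v * b * a)

/-- The words `zⁱ aʲ u v` with `u ∈ {1, b, ba}` and `v ∈ {1, c, cb, cba}`. -/
def SpinWordFour (z a b c w : G) : Prop :=
  ∃ v, SpinWordThree z a b v ∧ (w = v ∨ w = v * c ∨ w = v * c * b ∨ w = v * c * b * a)

namespace SpinFourRelations

variable (h : SpinFourRelations z a b c) {w : G}
include h

lemma wordTwo_mul_a (hw : SpinWordTwo z a w) : SpinWordTwo z a (w * a) := by
  rcases hw with rfl | rfl | rfl | rfl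
  · exact .inr (.inr (.inl rfl))
  · exact .inr (.inr (.inr rfl))
  · exact .inr (.inl (h.mul_a_a _))
  · exact .inl (by rw [h.mul_a_a, h.mul_z_z])

lemma wordTwo_mul_z (hw : SpinWordTwo z a w) : SpinWordTwo z a (w * z) := by
  rw [← h.mul_a_a]
  exact h.wordTwo_mul_a (h.wordTwo_mul_a hw)

lemma wordThree_mul_a (hw : SpinWordThree z a b w) : SpinWordThree z a b (w * a) := by
  obtain ⟨v, hv, rfl | rfl | rfl⟩ := hw
  · exact ⟨_, h.wordTwo_mul_a hv, .inl rfl⟩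
  · exact ⟨_, hv, .inr (.inr rfl)⟩
  · exact ⟨_, h.wordTwo_mul_z hv, .inr (.inl (by rw [h.mul_a_a, h.mul_b_z]))⟩

lemma wordThree_mul_b (hw : SpinWordThree z a b w) : SpinWordThree z a b (w * b) := by
  obtain ⟨v, hv, rfl | rfl | rfl⟩ := hw
  · exact ⟨_, hv, .inr (.inl rfl)⟩
  · exact ⟨_, h.wordTwo_mul_z hv, .inl (h.mul_b_b v)⟩
  · exact ⟨_, h.wordTwo_mul_a hv, .inr (.inr (h.mul_b_a_b v))⟩

lemma wordThree_mul_z (hw : SpinWordThree z a b w) : SpinWordThree z a b (w * z) := by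
  rw [← h.mul_a_a]
  exact h.wordThree_mul_a (h.wordThree_mul_a hw)

lemma wordFour_mul_a (hw : SpinWordFour z a b c w) : SpinWordFour z a b c (w * a) := by
  obtain ⟨v, hv, rfl | rfl | rfl | rfl⟩ := hw
  · exact ⟨_, h.wordThree_mul_a hv, .inl rfl⟩
  · exact ⟨_, h.wordThree_mul_a (h.wordThree_mul_z hv), .inr (.inl (h.mul_c_a v))⟩
  · exact ⟨_, hv, .inr (.inr (.inr rfl))⟩
  · exact ⟨_, h.wordThree_mul_z hv,
      .inr (.inr (.inl (by rw [h.mul_a_a, h.mul_b_z, h.mul_c_z])))⟩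

lemma wordFour_mul_b (hw : SpinWordFour z a b c w) : SpinWordFour z a b c (w * b) := by
  obtain ⟨v, hv, rfl | rfl | rfl | rfl⟩ := hw
  · exact ⟨_, h.wordThree_mul_b hv, .inl rfl⟩
  · exact ⟨_, hv, .inr (.inr (.inl rfl))⟩
  · exact ⟨_, h.wordThree_mul_z hv, .inr (.inl (by rw [h.mul_b_b, h.mul_c_z]))⟩
  · exact ⟨_, h.wordThree_mul_a (h.wordThree_mul_z hv),
      .inr (.inr (.inr (by rw [h.mul_b_a_b, h.mul_c_a])))⟩

lemma wordFour_mul_c (hw : SpinWordFour z a b c w) : SpinWordFour z a b c (w * c) := by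
  obtain ⟨v, hv, rfl | rfl | rfl | rfl⟩ := hw
  · exact ⟨_, hv, .inr (.inl rfl)⟩
  · exact ⟨_, h.wordThree_mul_z hv, .inl (h.mul_c_c v)⟩
  · exact ⟨_, h.wordThree_mul_b hv, .inr (.inr (.inl (h.mul_c_b_c v)))⟩
  · exact ⟨_, h.wordThree_mul_b (h.wordThree_mul_z hv),
      .inr (.inr (.inr (by rw [h.mul_a_c, h.mul_b_z, h.mul_c_z, h.mul_c_b_c])))⟩

lemma wordFour_mul_z (hw : SpinWordFour z a b c w) : SpinWordFour z a b c (w * z) := by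
  rw [← h.mul_a_a]
  exact h.wordFour_mul_a (h.wordFour_mul_a hw)

lemma wordFour_of_mem_closure (hw : w ∈ Subgroup.closure {z, a, b, c}) :
    SpinWordFour z a b c w := by
  have mul_mem : ∀ x, ∀ y ∈ ({z, a, b, c} : Set G), SpinWordFour z a b c x →
      SpinWordFour z a b c (x * y) := by
    rintro x y (rfl | rfl | rfl | rfl) hx
    exacts [h.wordFour_mul_z hx, h.wordFour_mul_a hx, h.wordFour_mul_b hx, h.wordFour_mul_c hx]
  have inv_eq : ∀ y ∈ ({z, a, b, c} : Set G), y⁻¹ = y * y * y := by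
    intro y hy
    have hy2 : y ^ 2 * y ^ 2 = 1 := by
      rcases hy with hy | hy | hy | hy <;> rw [hy]
      · rw [h.z_sq, one_mul]
      · rw [h.a_sq, ← sq, h.z_sq]
      · rw [h.b_sq, ← sq, h.z_sq]
      · rw [h.c_sq, ← sq, h.z_sq]
    exact inv_eq_of_mul_eq_one_left (by simpa [sq, mul_assoc] using hy2)
  induction hw using Subgroup.closure_induction_right with
  | one => exact ⟨1, ⟨1, .inl rfl, .inl rfl⟩, .inl rfl⟩
  | mul_right x _ y hy hx => exact mul_mem x y hy hx
  | mul_inv_cancel x _ y hy hx =>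
    rw [inv_eq y hy, ← mul_assoc, ← mul_assoc]
    exact mul_mem _ y hy (mul_mem _ y hy (mul_mem x y hy hx))

end SpinFourRelations

lemma SpinWordFour.exists_eq_spinNormalForm {w : G} (hw : SpinWordFour z a b c w) :
    ∃ x, w = spinNormalForm z a b c x := by
  obtain ⟨v, ⟨u, hu, hv⟩, hw⟩ := hw
  obtain ⟨i, j, hij⟩ : ∃ (i j : Fin 2), u = ![1, z] i * ![1, a] j := by
    rcases hu with rfl | rfl | rfl | rfl
    exacts [⟨0, 0, by simp⟩, ⟨1, 0, by simp⟩, ⟨0, 1, by simp⟩, ⟨1, 1, by simp⟩]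
  obtain ⟨k, hk⟩ : ∃ k : Fin 3, v = u * ![1, b, b * a] k := by
    rcases hv with rfl | rfl | rfl
    exacts [⟨0, by simp⟩, ⟨1, by simp⟩, ⟨2, by simp [mul_assoc]⟩]
  obtain ⟨l, hl⟩ : ∃ l : Fin 4, w = v * ![1, c, c * b, c * b * a] l := by
    rcases hw with rfl | rfl | rfl | rfl
    exacts [⟨0, by simp⟩, ⟨1, by simp⟩, ⟨2, by simp [mul_assoc]⟩, ⟨3, by simp [mul_assoc]⟩]
  exact ⟨(i, j, k, l), by rw [hl, hk, hij, spinNormalForm]⟩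


end NormalForm

section Presentation

lemma spinZ_sq (n : ℕ) : spinZ n ^ 2 = 1 :=
  PresentedGroup.one_of_mem (rels := spinRels n) (.inl (.inl (.inl rfl)))

lemma spinT_sq (n : ℕ) (i : Fin (n - 1)) : spinT n i ^ 2 = spinZ n :=
  mul_inv_eq_one.mp <| PresentedGroup.one_of_mem (rels := spinRels n) (.inl (.inl (.inr ⟨i, rfl⟩)))

lemma spinT_mul_spinT_cube (n : ℕ) (i j : Fin (n - 1)) (hij : (j : ℕ) = i + 1) :
    (spinT n i * spinT n j) ^ 3 = spinZ n :=
  mul_inv_eq_one.mp <|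
    PresentedGroup.one_of_mem (rels := spinRels n) (.inl (.inr ⟨i, j, hij, rfl⟩))

lemma spinT_mul_spinT_sq (n : ℕ) (i j : Fin (n - 1))
    (hij : (i : ℕ) + 2 ≤ j ∨ (j : ℕ) + 2 ≤ i) :
    (spinT n i * spinT n j) ^ 2 = spinZ n :=
  mul_inv_eq_one.mp <| PresentedGroup.one_of_mem (rels := spinRels n) (.inr ⟨i, j, hij, rfl⟩)

lemma spinSym_four_relations :
    SpinFourRelations (spinZ 4) (spinT 4 0) (spinT 4 1) (spinT 4 2) where
  z_sq := spinZ_sq 4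
  a_sq := spinT_sq 4 0
  b_sq := spinT_sq 4 1
  c_sq := spinT_sq 4 2
  ab_cube := spinT_mul_spinT_cube 4 0 1 rfl
  bc_cube := spinT_mul_spinT_cube 4 1 2 rfl
  ac_sq := spinT_mul_spinT_sq 4 0 2 (.inl le_rfl)

lemma exists_eq_spinNormalForm (w : SpinSym 4) :
    ∃ x, w = spinNormalForm (spinZ 4) (spinT 4 0) (spinT 4 1) (spinT 4 2) x := by
  refine (spinSym_four_relations.wordFour_of_mem_closure ?_).exists_eq_spinNormalForm
  have hw : w ∈ Subgroup.closure (Set.range (PresentedGroup.of (rels := spinRels 4))) := by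
    rw [PresentedGroup.closure_range_of]; trivial
  refine Subgroup.closure_mono ?_ hw
  rintro _ ⟨_ | i, rfl⟩
  · exact .inl rfl
  · change Fin 3 at i
    fin_cases i
    exacts [.inr (.inl rfl), .inr (.inr (.inl rfl)), .inr (.inr (.inr rfl))]

/-- The homomorphism from `S̃₄` determined by elements satisfying its defining relations. -/
def spinSymFourLift {G : Type*} [Group G] {z a b c : G} (h : SpinFourRelations z a b c) :
    SpinSym 4 →* G :=
  PresentedGroup.toGroup (rels := spinRels 4) (f := fun o => o.elim z ![a, b, c]) <| by
    have hca : (c * a) ^ 2 = z := by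
      have h1 := h.mul_c_a 1
      rw [one_mul, one_mul, mul_assoc] at h1
      have h2 : (c * a) ^ 2 = 1 * z * a * c * c * a := by
        nth_rewrite 1 [sq, h1]
        simp [mul_assoc]
      rw [h2, h.mul_c_c, h.mul_a_z, h.mul_z_z, h.mul_a_a, one_mul]
    rintro r (((rfl | ⟨i, rfl⟩) | ⟨i, j, hij, rfl⟩) | ⟨i, j, hij, rfl⟩)
    · simpa using h.z_sq
    · change Fin 3 at i
      fin_cases i
      · simpa [mul_inv_eq_one] using h.a_sq
      · simpa [mul_inv_eq_one] using h.b_sq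
      · simpa [mul_inv_eq_one] using h.c_sq
    · change Fin 3 at i j
      fin_cases i <;> fin_cases j <;> simp at hij
      · simpa [mul_inv_eq_one] using h.ab_cube
      · simpa [mul_inv_eq_one] using h.bc_cube
    · change Fin 3 at i j
      fin_cases i <;> fin_cases j <;> simp at hij
      · simpa [mul_inv_eq_one] using h.ac_sq
      · simpa [mul_inv_eq_one] using hca

lemma spinSymFourLift_spinNormalForm {G : Type*} [Group G] {z a b c : G}
    (h : SpinFourRelations z a b c) (x : Fin 2 × Fin 2 × Fin 3 × Fin 4) :
    spinSymFourLift h (spinNormalForm (spinZ 4) (spinT 4 0) (spinT 4 1) (spinT 4 2) x) =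
      spinNormalForm z a b c x := by
  rw [map_spinNormalForm]
  congr 1 <;> exact PresentedGroup.toGroup.of _

end Presentation

section Model

open Matrix

/-- The ring `𝔽₃[i]`, a field with nine elements. -/
abbrev GaussThree : Type := QuadraticAlgebra (ZMod 3) (-1) 0

/-- The image of `t₁` in `SL(2, 9)`. -/
abbrev spinMatA : SpecialLinearGroup (Fin 2) GaussThree :=
  ⟨!![⟨0, 1⟩, 0; 0, ⟨0, -1⟩], by decide +kernel⟩

/-- The image of `t₂` in `SL(2, 9)`. -/
abbrev spinMatB : SpecialLinearGroup (Fin 2) GaussThree :=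
  ⟨!![⟨0, 1⟩, 0; ⟨0, -1⟩, ⟨0, -1⟩], by decide +kernel⟩

/-- The image of `t₃` in `SL(2, 9)`. -/
abbrev spinMatC : SpecialLinearGroup (Fin 2) GaussThree :=
  ⟨!![0, ⟨0, 1⟩; ⟨0, 1⟩, 0], by decide +kernel⟩

/-- The image of `z` in `SL(2, 9)`. -/
abbrev spinMatZ : SpecialLinearGroup (Fin 2) GaussThree :=
  ⟨!![-1, 0; 0, -1], by decide +kernel⟩

/-- The inclusion of `SL(2, 3)` in `SL(2, 9)`. -/
abbrev slThreeToNine :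
    SpecialLinearGroup (Fin 2) (ZMod 3) →* SpecialLinearGroup (Fin 2) GaussThree :=
  SpecialLinearGroup.map (algebraMap (ZMod 3) GaussThree)

lemma spinMat_relations : SpinFourRelations spinMatZ spinMatA spinMatB spinMatC := by
  constructor <;> decide +kernel

lemma eq_zero_of_spinNormalForm_spinMat_eq_one :
    ∀ x, spinNormalForm spinMatZ spinMatA spinMatB spinMatC x = 1 → x = 0 := by
  decide +kernel

lemma exists_slThreeToNine_eq_spinNormalForm :
    ∀ x, spinNormalForm (1 : ℤˣ) (-1) (-1) (-1) x = 1 →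
      ∃ M, slThreeToNine M = spinNormalForm spinMatZ spinMatA spinMatB spinMatC x := by
  decide +kernel

lemma exists_spinNormalForm_eq_slThreeToNine :
    ∀ M, ∃ x, spinNormalForm (1 : ℤˣ) (-1) (-1) (-1) x = 1 ∧
      spinNormalForm spinMatZ spinMatA spinMatB spinMatC x = slThreeToNine M := by
  decide +kernel

lemma slThreeToNine_injective : Function.Injective slThreeToNine := by
  intro M N hMN
  ext i j
  have hij := congrArg (fun P : SpecialLinearGroup (Fin 2) GaussThree => P i j) hMN
  exact QuadraticAlgebra.algebraMap_injective hij

lemma spinSymFourLift_spinMat_injective :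
    Function.Injective (spinSymFourLift spinMat_relations) := by
  rw [injective_iff_map_eq_one]
  intro w hw
  obtain ⟨x, rfl⟩ := exists_eq_spinNormalForm w
  rw [spinSymFourLift_spinNormalForm] at hw
  rw [eq_zero_of_spinNormalForm_spinMat_eq_one x hw]
  simp [spinNormalForm]

end Model

lemma spinNormalForm_mem_spinAlt_iff {π : SpinSym 4 →* Equiv.Perm (Fin 4)} (hπ : IsSpinProj 4 π)
    (x : Fin 2 × Fin 2 × Fin 3 × Fin 4) :
    spinNormalForm (spinZ 4) (spinT 4 0) (spinT 4 1) (spinT 4 2) x ∈ SpinAlt 4 π ↔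
      spinNormalForm (1 : ℤˣ) (-1) (-1) (-1) x = 1 := by
  have hT : ∀ i, Equiv.Perm.sign (π (spinT 4 i)) = -1 := by
    intro i
    rw [hπ.2, Equiv.Perm.sign_swap]
    simp [finL, finR]
  rw [SpinAlt, Subgroup.mem_comap, Equiv.Perm.mem_alternatingGroup, map_spinNormalForm,
    map_spinNormalForm, hT, hT, hT, hπ.1, map_one]

/-- The double cover `Ã₄` is isomorphic to `SL(2, 3)`. -/
theorem spinAlt_four_iso_SL2_ZMod3
    (π : SpinSym 4 →* Equiv.Perm (Fin 4)) (hπ : IsSpinProj 4 π) :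
    Nonempty (↥(SpinAlt 4 π) ≃* Matrix.SpecialLinearGroup (Fin 2) (ZMod 3)) := by
  let φ := (spinSymFourLift spinMat_relations).comp (SpinAlt 4 π).subtype
  have hφ : Function.Injective φ :=
    spinSymFourLift_spinMat_injective.comp (SpinAlt 4 π).subtype_injective
  have hrange : φ.range = slThreeToNine.range := by
    ext P
    constructor
    · rintro ⟨⟨w, hw⟩, rfl⟩
      obtain ⟨x, rfl⟩ := exists_eq_spinNormalForm w
      obtain ⟨M, hM⟩ := exists_slThreeToNine_eq_spinNormalForm x
        ((spinNormalForm_mem_spinAlt_iff hπ x).mp hw)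
      exact ⟨M, hM.trans (spinSymFourLift_spinNormalForm spinMat_relations x).symm⟩
    · rintro ⟨M, rfl⟩
      obtain ⟨x, hx, hM⟩ := exists_spinNormalForm_eq_slThreeToNine M
      exact ⟨⟨_, (spinNormalForm_mem_spinAlt_iff hπ x).mpr hx⟩,
        (spinSymFourLift_spinNormalForm spinMat_relations x).trans hM⟩
  exact ⟨(MonoidHom.ofInjective hφ).trans
    ((MulEquiv.subgroupCongr hrange).trans (MonoidHom.ofInjective slThreeToNine_injective).symm)⟩
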